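/- arXiv:0912.5124 — 3 statements merged into one kernel-verified Lean document; each statement's English description precedes it below -/
import Mathlib

section
/- Write P = Σ_{s≥0} x^{ρ-s} P_s(∂) with ρ ∈ ℤ and P_s ∈ ℂ[X] of degree ≤ n, and suppose P_i^{(j)}(0) = 0 for all i + j < m and P_0^{(m)}(0) ≠ 0. Let μ_1, …, μ_r ∈ ℂ satisfy μ_i − μ_{i'} ∉ ℤ for i ≠ i', and let m_1, …, m_r be positive integers with m = Σ_{i=1}^{r} m_i. Then the following are equivalent: (1) for every i = 1..r and j = 0..m_i−1 there exists h_{ij} ∈ ℂ[[x^{-1}]] such that x^{−μ_i−j} + x^{−μ_i−m_i} h_{ij}(x) is a formal solution of Pu = 0; (2) p_k(−μ_i−j−k) = 0 for all i = 1..r, j = 0..m_i−1, and k = m, m+1, …, m+m_i−j−1. -/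
open Polynomial Finset

noncomputable section

/-- `p_k(λ) = Σ_{i=0}^{k} (λ+i+1)_{k-i} · P_i^{(k-i)}(0)/(k-i)!`, where
`(λ)_l` is the rising factorial. -/
def pk (P : ℕ → Polynomial ℂ) (k : ℕ) (lam : ℂ) : ℂ :=
  ∑ i ∈ range (k + 1),
    (∏ t ∈ range (k - i), (lam + (i : ℂ) + 1 + (t : ℂ))) *
      ((derivative^[k - i] (P i)).eval 0 / (Nat.factorial (k - i) : ℂ))

/-- `x^μ Σ_{s≥0} c_s x^{-s}` is a formal solution of `Pu = 0` for
`P = Σ_{s≥0} x^{ρ-s} P_s(∂)`: for every `i ≥ 0`,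
`Σ_{s+j+t=i} c_t · (coeff of X^j in P_s) · (μ-t)(μ-t-1)⋯(μ-t-j+1) = 0`. -/
def IsFormalSolAtInf (P : ℕ → Polynomial ℂ) (μ : ℂ) (c : ℕ → ℂ) : Prop :=
  ∀ i : ℕ,
    ∑ s ∈ range (i + 1), ∑ j ∈ range (i - s + 1),
      c (i - s - j) * (P s).coeff j *
        ∏ u ∈ range j, (μ - ((i - s - j : ℕ) : ℂ) - (u : ℂ)) = 0

/-- With `λ = ν - k` the rising factorials in `p_k(λ)` become falling factorials in `ν`, so
`p_k(ν - k)` is the coefficient of `x^{ρ+ν-k}` in `P x^ν`. -/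
theorem pk_sub_eq_sum (P : ℕ → Polynomial ℂ) (k : ℕ) (ν : ℂ) :
    pk P k (ν - k) =
      ∑ i ∈ range (k + 1), (P i).coeff (k - i) * ∏ u ∈ range (k - i), (ν - (u : ℂ)) := by
  refine Finset.sum_congr rfl fun i hi => ?_
  have hik : i ≤ k := Nat.lt_succ_iff.mp (Finset.mem_range.mp hi)
  have hc : (derivative^[k - i] (P i)).eval 0 / (Nat.factorial (k - i) : ℂ)
      = (P i).coeff (k - i) := by
    rw [← Polynomial.coeff_zero_eq_eval_zero, Polynomial.coeff_iterate_derivative, zero_add,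
      Nat.descFactorial_self, nsmul_eq_mul,
      mul_div_cancel_left₀ _ (Nat.cast_ne_zero.mpr (Nat.factorial_ne_zero _))]
  rw [hc, mul_comm, ← Finset.prod_range_reflect (fun u : ℕ => ν - (u : ℂ))]
  congr 1
  refine Finset.prod_congr rfl fun t ht => ?_
  obtain ⟨d, hd⟩ := Nat.exists_eq_add_of_lt (Finset.mem_range.mp ht)
  have h1 : k - i - 1 - t = d := by omega
  have h2 : (k : ℂ) = i + t + d + 1 := by exact_mod_cast (by omega : k = i + t + d + 1)
  rw [h1, h2]
  ring

theorem isFormalSolAtInf_iff_sum_pk (P : ℕ → Polynomial ℂ) (ν : ℂ) (c : ℕ → ℂ) :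
    IsFormalSolAtInf P ν c ↔
      ∀ i : ℕ, ∑ t ∈ range (i + 1), c t * pk P (i - t) (ν - t - (i - t : ℕ)) = 0 := by
  refine forall_congr' fun i => ?_
  rw [Eq.congr_left]
  calc
    _ = ∑ s ∈ range (i + 1), ∑ t ∈ range (i - s + 1),
        c t * (P s).coeff (i - s - t) * ∏ u ∈ range (i - s - t), (ν - (t : ℂ) - (u : ℂ)) := by
      refine Finset.sum_congr rfl fun s _ => ?_
      rw [← Finset.sum_range_reflect]
      refine Finset.sum_congr rfl fun t ht => ?_
      have ht' := Finset.mem_range.mp ht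
      have h1 : i - s + 1 - 1 - t = i - s - t := by omega
      have h2 : i - s - (i - s - t) = t := by omega
      rw [h1, h2]
    _ = ∑ t ∈ range (i + 1), ∑ s ∈ range (i - t + 1),
        c t * (P s).coeff (i - s - t) * ∏ u ∈ range (i - s - t), (ν - (t : ℂ) - (u : ℂ)) := by
      refine Finset.sum_comm' fun s t => ?_
      simp only [Finset.mem_range]
      omega
    _ = _ := by
      refine Finset.sum_congr rfl fun t _ => ?_
      rw [pk_sub_eq_sum, Finset.mul_sum]
      refine Finset.sum_congr rfl fun s _ => ?_
      rw [Nat.sub_right_comm i s t, mul_assoc]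

theorem pk_eq_zero_of_lt {P : ℕ → Polynomial ℂ} {m : ℕ}
    (hvan : ∀ i j : ℕ, i + j < m → (derivative^[j] (P i)).eval 0 = 0)
    {k : ℕ} (hk : k < m) (lam : ℂ) : pk P k lam = 0 := by
  refine Finset.sum_eq_zero fun i hi => ?_
  have := Finset.mem_range.mp hi
  rw [hvan i (k - i) (by omega), zero_div, mul_zero]

/-- The first `m` coefficients of `Pu` vanish automatically, and the later ones only involve
`p_k` with `k ≥ m`. -/
theorem isFormalSolAtInf_iff_sum_pk_add {P : ℕ → Polynomial ℂ} {m : ℕ}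
    (hvan : ∀ i j : ℕ, i + j < m → (derivative^[j] (P i)).eval 0 = 0) (ν : ℂ) (c : ℕ → ℂ) :
    IsFormalSolAtInf P ν c ↔
      ∀ N : ℕ, ∑ t ∈ range (N + 1), c t * pk P (m + N - t) (ν - t - (m + N - t : ℕ)) = 0 := by
  have hsum : ∀ N : ℕ, ∑ t ∈ range (N + 1), c t * pk P (m + N - t) (ν - t - (m + N - t : ℕ)) =
      ∑ t ∈ range (m + N + 1), c t * pk P (m + N - t) (ν - t - (m + N - t : ℕ)) := by
    intro N
    refine Finset.sum_subset (Finset.range_mono (by omega)) fun t ht ht' => ?_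
    rw [Finset.mem_range] at ht ht'
    rw [pk_eq_zero_of_lt hvan (by omega), mul_zero]
  rw [isFormalSolAtInf_iff_sum_pk]
  refine ⟨fun h N => (hsum N).trans (h (m + N)), fun h i => ?_⟩
  rcases lt_or_ge i m with hi | hi
  · refine Finset.sum_eq_zero fun t _ => ?_
    rw [pk_eq_zero_of_lt hvan (by omega), mul_zero]
  · obtain ⟨N, rfl⟩ := Nat.exists_eq_add_of_le hi
    exact (hsum N).symm.trans (h N)

/-- The polynomial `ν ↦ p_k(ν - k)`. -/
def indicialPoly (P : ℕ → Polynomial ℂ) (k : ℕ) : Polynomial ℂ :=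
  ∑ i ∈ range (k + 1), C ((P i).coeff (k - i)) * descPochhammer ℂ (k - i)

theorem eval_indicialPoly (P : ℕ → Polynomial ℂ) (k : ℕ) (ν : ℂ) :
    (indicialPoly P k).eval ν = pk P k (ν - k) := by
  rw [pk_sub_eq_sum, indicialPoly, Polynomial.eval_finsetSum]
  refine Finset.sum_congr rfl fun i _ => ?_
  rw [Polynomial.eval_mul, Polynomial.eval_C, descPochhammer_eval_eq_prod_range]

theorem natDegree_indicialPoly_le (P : ℕ → Polynomial ℂ) (k : ℕ) :
    (indicialPoly P k).natDegree ≤ k :=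
  Polynomial.natDegree_sum_le_of_forall_le _ _ fun i _ =>
    (Polynomial.natDegree_C_mul_le _ _).trans
      ((descPochhammer_natDegree (R := ℂ) (k - i)).le.trans (Nat.sub_le k i))

theorem coeff_indicialPoly_self (P : ℕ → Polynomial ℂ) (k : ℕ) :
    (indicialPoly P k).coeff k = (P 0).coeff k := by
  rw [indicialPoly, Polynomial.finsetSum_coeff, Finset.sum_eq_single 0]
  · have h := (monic_descPochhammer ℂ k).coeff_natDegree
    rw [descPochhammer_natDegree] at h
    rw [Nat.sub_zero, Polynomial.coeff_C_mul, h, mul_one]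
  · intro i hi hi0
    have := Finset.mem_range.mp hi
    rw [Polynomial.coeff_C_mul, Polynomial.coeff_eq_zero_of_natDegree_lt (p := descPochhammer ℂ (k - i)),
      mul_zero]
    rw [descPochhammer_natDegree]
    omega
  · simp

theorem Polynomial.mem_range_of_eval_eq_zero {R ι : Type*} [CommRing R] [IsDomain R]
    [Fintype ι] {p : Polynomial R} (hp : p ≠ 0) (hcard : p.natDegree ≤ Fintype.card ι)
    {f : ι → R} (hf : Function.Injective f) (hroot : ∀ i, p.eval (f i) = 0) {z : R}
    (hz : p.eval z = 0) : z ∈ Set.range f := by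
  classical
  by_contra hmem
  refine hp (Polynomial.eq_zero_of_natDegree_lt_card_of_eval_eq_zero' p
    (insert z (Finset.univ.image f)) ?_ ?_)
  · simpa [hz] using hroot
  · rw [Finset.card_insert_of_notMem (by simpa using hmem), Finset.card_image_of_injective _ hf,
      Finset.card_univ]
    omega

/-- The solution `c` of `∑_{t ≤ N} c_t b_{t,N} = 0` for `N ≥ L`, with `c_0 = 1` and `c_s = 0` for
`0 < s < L`. -/
def recCoeff (L : ℕ) (b : ℕ → ℕ → ℂ) (N : ℕ) : ℂ :=
  if N = 0 then 1 else if N < L then 0 else -(∑ t : Fin N, recCoeff L b t * b t N) / b N N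
termination_by N
decreasing_by exact t.2

theorem recCoeff_zero (L : ℕ) (b : ℕ → ℕ → ℂ) : recCoeff L b 0 = 1 := by
  rw [recCoeff, if_pos rfl]

theorem recCoeff_of_lt {L : ℕ} (b : ℕ → ℕ → ℂ) {s : ℕ} (hs : 1 ≤ s) (hsL : s < L) :
    recCoeff L b s = 0 := by
  rw [recCoeff, if_neg (by omega), if_pos hsL]

theorem sum_recCoeff_mul_eq_zero {L : ℕ} (hL : 0 < L) {b : ℕ → ℕ → ℂ} {N : ℕ} (hN : L ≤ N)
    (hb : b N N ≠ 0) : ∑ t ∈ range (N + 1), recCoeff L b t * b t N = 0 := by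
  rw [Finset.sum_range_succ, recCoeff.eq_def L b N, if_neg (by omega), if_neg (by omega),
    div_mul_cancel₀ _ hb, Fin.sum_univ_eq_sum_range (fun t => recCoeff L b t * b t N) N,
    add_neg_cancel]

theorem neg_sub_natCast_inj {r : ℕ} {μ : Fin r → ℂ}
    (hμ : ∀ i i', i ≠ i' → ∀ z : ℤ, μ i - μ i' ≠ (z : ℂ)) {i i' : Fin r} {a b : ℕ}
    (h : -μ i - (a : ℂ) = -μ i' - (b : ℂ)) : i = i' ∧ a = b := by
  have hi : i = i' := by
    by_contra hne
    refine hμ i i' hne ((b : ℤ) - a) ?_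
    push_cast
    linear_combination -h
  subst hi
  exact ⟨rfl, by exact_mod_cast sub_right_injective h⟩

theorem stmt1 (n : ℕ) (P : ℕ → Polynomial ℂ) (hdeg : ∀ s, (P s).degree ≤ (n : ℕ))
    (m : ℕ)
    (hvan : ∀ i j : ℕ, i + j < m → (derivative^[j] (P i)).eval 0 = 0)
    (hnz : (derivative^[m] (P 0)).eval 0 ≠ 0)
    (r : ℕ) (μ : Fin r → ℂ)
    (hμ : ∀ i i', i ≠ i' → ∀ z : ℤ, μ i - μ i' ≠ (z : ℂ))
    (mm : Fin r → ℕ) (hmm : ∀ i, 0 < mm i) (hm : m = ∑ i, mm i) :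
    (∀ i : Fin r, ∀ j < mm i,
        ∃ c : ℕ → ℂ, c 0 = 1 ∧ (∀ s, 1 ≤ s → s < mm i - j → c s = 0) ∧
          IsFormalSolAtInf P (-μ i - (j : ℂ)) c) ↔
      (∀ i : Fin r, ∀ j < mm i, ∀ k, m ≤ k → k < m + (mm i - j) →
        pk P k (-μ i - (j : ℂ) - (k : ℂ)) = 0) := by
  have hsingle : ∀ (ν : ℂ) (c : ℕ → ℂ) (L N : ℕ), c 0 = 1 → (∀ s, 1 ≤ s → s < L → c s = 0) →
      N < L → ∑ t ∈ range (N + 1), c t * pk P (m + N - t) (ν - t - (m + N - t : ℕ)) =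
        pk P (m + N) (ν - (m + N : ℕ)) := by
    intro ν c L N hc0 hc hN
    rw [Finset.sum_eq_single 0]
    · simp [hc0]
    · intro t ht ht0
      have := Finset.mem_range.mp ht
      rw [hc t (by omega) (by omega), zero_mul]
    · simp
  constructor
  · intro h i j hj k hmk hk
    obtain ⟨N, rfl⟩ := Nat.exists_eq_add_of_le hmk
    obtain ⟨c, hc0, hc, hsol⟩ := h i j hj
    rw [← hsingle _ c (mm i - j) N hc0 hc (by omega)]
    exact (isFormalSolAtInf_iff_sum_pk_add hvan _ c).mp hsol N
  · intro h i j hj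
    let b : ℕ → ℕ → ℂ := fun t N =>
      pk P (m + N - t) (-μ i - (j : ℂ) - t - (m + N - t : ℕ))
    have hc0 := recCoeff_zero (mm i - j) b
    have hc : ∀ s, 1 ≤ s → s < mm i - j → recCoeff (mm i - j) b s = 0 :=
      fun s => recCoeff_of_lt b
    refine ⟨recCoeff (mm i - j) b, hc0, hc, ?_⟩
    rw [isFormalSolAtInf_iff_sum_pk_add hvan]
    intro N
    rcases lt_or_ge N (mm i - j) with hN | hN
    · rw [hsingle _ _ _ N hc0 hc hN]
      exact h i j hj (m + N) (by omega) (by omega)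
    · refine sum_recCoeff_mul_eq_zero (by omega) hN fun hb => ?_
      have hcoeff : (P 0).coeff m ≠ 0 := by
        intro h0
        rw [← Polynomial.coeff_zero_eq_eval_zero, Polynomial.coeff_iterate_derivative, zero_add,
          h0, smul_zero] at hnz
        exact hnz rfl
      have hp : indicialPoly P m ≠ 0 := by
        intro h0
        rw [← coeff_indicialPoly_self, h0, Polynomial.coeff_zero] at hcoeff
        exact hcoeff rfl
      have hz : (indicialPoly P m).eval (-μ i - ((j + N : ℕ) : ℂ)) = 0 := by
        rw [eval_indicialPoly, Nat.cast_add, ← sub_sub, ← hb]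
        simp only [b, Nat.add_sub_cancel]
      obtain ⟨⟨i', j'⟩, hij⟩ := Polynomial.mem_range_of_eval_eq_zero
        (ι := Σ i, Fin (mm i)) (f := fun x => -μ x.1 - ((x.2 : ℕ) : ℂ)) hp
        ((natDegree_indicialPoly_le P m).trans (by simp [hm]))
        (by
          rintro ⟨i₁, j₁⟩ ⟨i₂, j₂⟩ heq
          obtain ⟨rfl, hj'⟩ := neg_sub_natCast_inj hμ heq
          exact congrArg (Sigma.mk i₁) (Fin.ext hj'))
        (fun x => by
          rw [eval_indicialPoly]
          exact h x.1 x.2 x.2.2 m le_rfl (by have := x.2.2; omega)) hz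
      obtain ⟨rfl, hj'⟩ := neg_sub_natCast_inj hμ hij
      have := j'.2
      omega
end
end

section
/- With the root-lattice data and associated element α as in the context, define the rigidity index idx = −((p+1)n² − Σ_{i=1}^{r} n_i² − Σ_{i=1}^{r} Σ_{j=1}^{l_i} (n^i_j)² − Σ_{j=1}^{p} Σ_{l=0}^{s_j} (m^j_l)² − Σ_{i=1}^{r} Σ_{j=1}^{l_i} Σ_{k=1}^{t_{ij}} (n^{ij}_k)²). Then (α, α) = idx. -/
open Finset

noncomputable section

/-- Index triples `(i,j,k)`. -/
abbrev Idx : Type := ℕ × ℕ × ℕ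

/-- The index set `I = {(i,j,k) : 0 ≤ i ≤ r, 1 ≤ j ≤ l_i, 1 ≤ k ≤ t_{ij}}`. -/
def S (r : ℕ) (L : ℕ → ℕ) (T : ℕ → ℕ → ℕ) : Finset Idx :=
  (range (r + 1)).biUnion fun i =>
    (Icc 1 (L i)).biUnion fun j =>
      (Icc 1 (T i j)).image fun k => (i, j, k)

/-- The pairing of basis vectors: `(v^{ij}_k, v^{ij}_k) = 2`;
`(v^{ij}_k, v^{ij}_{k'}) = −1` if `|k − k'| = 1`;
`(v^{ij}_1, v^{i'j'}_1) = −1` if `i ≠ i'`; all other pairs are `0`. -/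
def K : Idx → Idx → ℝ := fun a b =>
  if a = b then 2
  else if a.1 = b.1 ∧ a.2.1 = b.2.1 ∧ (a.2.2 = b.2.2 + 1 ∨ b.2.2 = a.2.2 + 1) then -1
  else if a.2.2 = 1 ∧ b.2.2 = 1 ∧ a.1 ≠ b.1 then -1
  else 0

/-- The symmetric bilinear form on `𝔥` (vectors are given by their coordinates
in the basis `{v^{ij}_k : (i,j,k) ∈ I}`, i.e. functions supported on `I`). -/
def form (r : ℕ) (L : ℕ → ℕ) (T : ℕ → ℕ → ℕ) (u v : Idx → ℝ) : ℝ :=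
  ∑ a ∈ S r L T, ∑ b ∈ S r L T, u a * v b * K a b

/-- `ñ^{0j}_k = Σ_{l=k}^{s_j} m^j_l` and `ñ^{ij}_k = Σ_{l=k}^{t_{ij}} n^{ij}_l`
for `i ≥ 1`. -/
def tilde (T : ℕ → ℕ → ℕ) (m : ℕ → ℕ → ℕ) (nn : ℕ → ℕ → ℕ → ℕ) : Idx → ℝ :=
  fun a =>
    if a.1 = 0 then ∑ l ∈ Icc a.2.2 (T 0 a.2.1), (m a.2.1 l : ℝ)
    else ∑ l ∈ Icc a.2.2 (T a.1 a.2.1), (nn a.1 a.2.1 l : ℝ)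

/-- The lattice element `α = Σ_{(i,j,k)∈I} ñ^{ij}_k v^{ij}_k` associated to the
multiplicity data `(m, nn)`. -/
def assoc (r : ℕ) (L : ℕ → ℕ) (T : ℕ → ℕ → ℕ) (m : ℕ → ℕ → ℕ)
    (nn : ℕ → ℕ → ℕ → ℕ) : Idx → ℝ :=
  fun a => if a ∈ S r L T then tilde T m nn a else 0

theorem sum_range_add_one_eq_add_sum_Icc (N : ℕ) (f : ℕ → ℝ) :
    ∑ i ∈ range (N + 1), f i = f 0 + ∑ i ∈ Icc 1 N, f i := by
  rw [range_eq_Ico, sum_eq_sum_Ico_succ_bot N.add_one_pos, zero_add, Ico_add_one_right_eq_Icc]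

theorem mem_S {r : ℕ} {L : ℕ → ℕ} {T : ℕ → ℕ → ℕ} {i j k : ℕ} :
    (i, j, k) ∈ S r L T ↔ i ≤ r ∧ (1 ≤ j ∧ j ≤ L i) ∧ 1 ≤ k ∧ k ≤ T i j := by
  simp only [S, mem_biUnion, mem_range, mem_Icc, mem_image, Prod.mk.injEq]
  constructor
  · rintro ⟨i', hi, j', hj, k', hk, rfl, rfl, rfl⟩
    exact ⟨by omega, hj, hk⟩
  · rintro ⟨hi, hj, hk⟩
    exact ⟨i, by omega, j, hj, k, hk, rfl, rfl, rfl⟩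

theorem sum_S (r : ℕ) (L : ℕ → ℕ) (T : ℕ → ℕ → ℕ) (f : Idx → ℝ) :
    ∑ a ∈ S r L T, f a =
      ∑ i ∈ range (r + 1), ∑ j ∈ Icc 1 (L i), ∑ k ∈ Icc 1 (T i j), f (i, j, k) := by
  unfold S
  rw [sum_biUnion]
  · refine sum_congr rfl fun i _ => ?_
    rw [sum_biUnion]
    · refine sum_congr rfl fun j _ => ?_
      rw [sum_image]
      intro k _ k' _ h
      simpa using h
    · intro j _ j' _ hne
      simp only [Function.onFun, disjoint_left, mem_image]
      rintro _ ⟨k, _, rfl⟩ ⟨k', _, h⟩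
      simp only [Prod.mk.injEq] at h
      exact hne h.2.1.symm
  · intro i _ i' _ hne
    simp only [Function.onFun, disjoint_left, mem_image, mem_biUnion]
    rintro _ ⟨j, _, k, _, rfl⟩ ⟨j', _, k', _, h⟩
    simp only [Prod.mk.injEq] at h
    exact hne h.1.symm

/-- The successor of a vertex along its leg. -/
def legSucc (a : Idx) : Idx := (a.1, a.2.1, a.2.2 + 1)

theorem K_eq (a b : Idx) :
    K a b = 2 * (if b = a then 1 else 0) - (if b = legSucc a then 1 else 0)
      - (if a = legSucc b then 1 else 0)
      - (if a.2.2 = 1 then 1 else 0) * (if b.2.2 = 1 then 1 else 0)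
        * (1 - if b.1 = a.1 then 1 else 0) := by
  obtain ⟨i, j, k⟩ := a
  obtain ⟨i', j', k'⟩ := b
  simp only [K, legSucc, Prod.mk.injEq]
  split_ifs <;> first | (exfalso; omega) | norm_num

/-- The form splits into the contributions of the legs and of the pairs of first vertices. -/
theorem form_self (r : ℕ) (L : ℕ → ℕ) (T : ℕ → ℕ → ℕ) (u : Idx → ℝ)
    (hu : ∀ a ∉ S r L T, u a = 0) :
    form r L T u u = ∑ a ∈ S r L T, (2 * u a ^ 2 - 2 * (u a * u (legSucc a)))
      - ((∑ a ∈ S r L T, if a.2.2 = 1 then u a else 0) ^ 2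
        - ∑ a ∈ S r L T, ∑ b ∈ S r L T,
          if b.1 = a.1 then
            (if a.2.2 = 1 then u a else 0) * (if b.2.2 = 1 then u b else 0) else 0) := by
  have hs : ∀ a, ∑ b ∈ S r L T, (if b = legSucc a then u a * u b else 0)
      = u a * u (legSucc a) := by
    intro a
    rw [sum_ite_eq']
    split_ifs with h
    · rfl
    · rw [hu _ h, mul_zero]
  have hd : ∀ a ∈ S r L T, ∑ b ∈ S r L T, (if b = a then u a * u b else 0) = u a ^ 2 := by
    intro a ha
    rw [sum_ite_eq', if_pos ha, sq]
  have hs' : ∑ a ∈ S r L T, ∑ b ∈ S r L T, (if a = legSucc b then u a * u b else 0)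
      = ∑ a ∈ S r L T, u a * u (legSucc a) := by
    rw [sum_comm]
    refine sum_congr rfl fun a _ => ?_
    rw [← hs a]
    simp only [mul_comm]
  have key : ∀ a b, u a * u b * K a b = 2 * (if b = a then u a * u b else 0)
      - (if b = legSucc a then u a * u b else 0) - (if a = legSucc b then u a * u b else 0)
      - (if a.2.2 = 1 then u a else 0) * (if b.2.2 = 1 then u b else 0)
      + (if b.1 = a.1 then
            (if a.2.2 = 1 then u a else 0) * (if b.2.2 = 1 then u b else 0) else 0) := by
    intro a b
    rw [K_eq]
    simp only [← mul_boole _ (u a * u b), ← mul_boole _ (u a), ← mul_boole _ (u b),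
      ← mul_boole _ (_ * _)]
    ring
  simp only [form, key, sum_add_distrib, sum_sub_distrib, ← mul_sum, hs', hs, ← sum_mul]
  rw [sum_congr rfl hd]
  ring

theorem sum_first (r : ℕ) (L : ℕ → ℕ) (T : ℕ → ℕ → ℕ) (u : Idx → ℝ)
    (hT : ∀ i ≤ r, ∀ j, 1 ≤ j → j ≤ L i → 1 ≤ T i j) (P : ℕ → Prop) [DecidablePred P] :
    ∑ a ∈ S r L T, (if P a.1 then (if a.2.2 = 1 then u a else 0) else 0) =
      ∑ i ∈ range (r + 1), if P i then ∑ j ∈ Icc 1 (L i), u (i, j, 1) else 0 := by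
  rw [sum_S]
  refine sum_congr rfl fun i hi => ?_
  split_ifs with h
  · refine sum_congr rfl fun j hj => ?_
    rw [mem_Icc] at hj
    rw [sum_ite_eq' (Icc 1 (T i j)) 1 fun k => u (i, j, k), if_pos]
    exact mem_Icc.2 ⟨le_rfl, hT i (by simpa [Nat.lt_succ_iff] using hi) j hj.1 hj.2⟩
  · simp

theorem sum_leg (t : ℕ) (w x : ℕ → ℝ) (hx : ∀ k, x k = ∑ l ∈ Icc k t, w l) :
    ∑ k ∈ Icc 1 t, (2 * x k ^ 2 - 2 * (x k * x (k + 1))) =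
      x 1 ^ 2 + ∑ k ∈ Icc 1 t, w k ^ 2 := by
  have hstep : ∀ k ∈ Icc 1 t, 2 * x k ^ 2 - 2 * (x k * x (k + 1))
      = w k ^ 2 - (x (k + 1) ^ 2 - x k ^ 2) := by
    intro k hk
    have : x k = w k + x (k + 1) := by
      rw [hx, hx, ← add_sum_Ioc_eq_sum_Icc (mem_Icc.1 hk).2,
        Icc_add_one_left_eq_Ioc]
    rw [this]
    ring
  have hlast : x (t + 1) = 0 := by rw [hx, Icc_eq_empty (by omega), sum_empty]
  have htel : ∑ k ∈ Icc 1 t, (x (k + 1) ^ 2 - x k ^ 2) = x (t + 1) ^ 2 - x 1 ^ 2 := by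
    rw [← Ico_add_one_right_eq_Icc, sum_Ico_sub (fun k => x k ^ 2) (by omega)]
  rw [sum_congr rfl hstep, sum_sub_distrib, htel, hlast]
  ring

theorem assoc_of_le {r : ℕ} {L : ℕ → ℕ} {T : ℕ → ℕ → ℕ} (m : ℕ → ℕ → ℕ)
    (nn : ℕ → ℕ → ℕ → ℕ) {i j k : ℕ} (hi : i ≤ r) (hj : 1 ≤ j ∧ j ≤ L i) (hk : 1 ≤ k) :
    assoc r L T m nn (i, j, k) = tilde T m nn (i, j, k) := by
  unfold assoc
  split_ifs with h
  · rfl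
  · have : T i j < k := by
      by_contra hc
      exact h (mem_S.2 ⟨hi, hj, hk, by omega⟩)
    rcases Nat.eq_zero_or_pos i with rfl | hi0
    · simp [tilde, Icc_eq_empty_of_lt this]
    · simp [tilde, Icc_eq_empty_of_lt this, hi0.ne']

theorem form_assoc (r : ℕ) (L : ℕ → ℕ) (T : ℕ → ℕ → ℕ) (m : ℕ → ℕ → ℕ)
    (nn : ℕ → ℕ → ℕ → ℕ) (hT : ∀ i ≤ r, ∀ j, 1 ≤ j → j ≤ L i → 1 ≤ T i j) :
    form r L T (assoc r L T m nn) (assoc r L T m nn) =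
      ∑ i ∈ range (r + 1), ∑ j ∈ Icc 1 (L i), (tilde T m nn (i, j, 1) ^ 2
          + ∑ k ∈ Icc 1 (T i j), (if i = 0 then (m j k : ℝ) else nn i j k) ^ 2)
        - ((∑ i ∈ range (r + 1), ∑ j ∈ Icc 1 (L i), tilde T m nn (i, j, 1)) ^ 2
          - ∑ i ∈ range (r + 1), (∑ j ∈ Icc 1 (L i), tilde T m nn (i, j, 1)) ^ 2) := by
  have hfirst : ∀ i ∈ range (r + 1), ∑ j ∈ Icc 1 (L i), assoc r L T m nn (i, j, 1) =
      ∑ j ∈ Icc 1 (L i), tilde T m nn (i, j, 1) := fun i hi =>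
    sum_congr rfl fun j hj => assoc_of_le m nn (by simpa [Nat.lt_succ_iff] using hi)
      (mem_Icc.1 hj) le_rfl
  rw [form_self r L T (assoc r L T m nn) fun a ha => if_neg ha]
  congr 1
  · rw [sum_S]
    refine sum_congr rfl fun i hi => sum_congr rfl fun j hj => ?_
    rw [← sum_leg (T i j) (fun k => if i = 0 then (m j k : ℝ) else nn i j k)
      fun k => tilde T m nn (i, j, k)]
    · refine sum_congr rfl fun k hk => ?_
      have hi' : i ≤ r := by simpa [Nat.lt_succ_iff] using hi
      rw [legSucc, assoc_of_le m nn hi' (mem_Icc.1 hj) (mem_Icc.1 hk).1,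
        assoc_of_le m nn hi' (mem_Icc.1 hj) (Nat.le_add_left 1 k)]
    · intro k
      by_cases h : i = 0
      · subst h
        simp [tilde]
      · simp [tilde, h]
  congr 1
  · have := sum_first r L T (assoc r L T m nn) hT fun _ => True
    simp only [if_true] at this
    rw [this, sum_congr rfl hfirst]
  · have hinner : ∀ a ∈ S r L T, (∑ b ∈ S r L T, if b.1 = a.1 then
        (if a.2.2 = 1 then assoc r L T m nn a else 0)
          * (if b.2.2 = 1 then assoc r L T m nn b else 0) else 0) =
        (if a.2.2 = 1 then assoc r L T m nn a
          * ∑ j ∈ Icc 1 (L a.1), tilde T m nn (a.1, j, 1) else 0) := by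
      rintro ⟨i, j, k⟩ ha
      have hi : i ∈ range (r + 1) := mem_range.2 (Nat.lt_succ_of_le (mem_S.1 ha).1)
      simp only [← mul_ite_zero]
      rw [← mul_sum, sum_first r L T _ hT fun i' => i' = i, sum_ite_eq', if_pos hi, hfirst i hi,
        ite_mul, zero_mul, mul_ite, mul_zero]
    rw [sum_congr rfl hinner]
    have := sum_first r L T (fun a => assoc r L T m nn a
      * ∑ j ∈ Icc 1 (L a.1), tilde T m nn (a.1, j, 1)) hT fun _ => True
    simp only [if_true] at this
    rw [this]
    refine sum_congr rfl fun i hi => ?_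
    rw [← sum_mul, hfirst i hi, sq]

/-- with the root-lattice data and associated element `α`,
`(α, α) = idx`, where
`idx = −((p+1)n² − Σ_i n_i² − Σ_{i,j} (n^i_j)² − Σ_{j=1}^{p} Σ_{l=0}^{s_j} (m^j_l)²
− Σ_{i,j,k} (n^{ij}_k)²)`. -/
theorem stmt11 (p r n : ℕ) (hp : 1 ≤ p) (hr : 1 ≤ r) (hn : 1 ≤ n)
    (L : ℕ → ℕ) (hL0 : L 0 = p) (hL : ∀ i ≤ r, 1 ≤ L i)
    (T : ℕ → ℕ → ℕ) (hT : ∀ i ≤ r, ∀ j, 1 ≤ j → j ≤ L i → 1 ≤ T i j)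
    (m : ℕ → ℕ → ℕ) (nn : ℕ → ℕ → ℕ → ℕ)
    (hm : ∀ j, 1 ≤ j → j ≤ p → ∑ l ∈ range (T 0 j + 1), m j l = n)
    (hnn : ∀ i j k, 1 ≤ i → i ≤ r → 1 ≤ j → j ≤ L i → 1 ≤ k → k ≤ T i j →
      0 < nn i j k)
    (hsum : ∑ i ∈ Icc 1 r, ∑ j ∈ Icc 1 (L i), ∑ k ∈ Icc 1 (T i j), nn i j k = n) :
    form r L T (assoc r L T m nn) (assoc r L T m nn) =
      -(((p : ℝ) + 1) * (n : ℝ) ^ 2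
        - ∑ i ∈ Icc 1 r,
            (∑ j ∈ Icc 1 (L i), ∑ k ∈ Icc 1 (T i j), (nn i j k : ℝ)) ^ 2
        - ∑ i ∈ Icc 1 r, ∑ j ∈ Icc 1 (L i),
            (∑ k ∈ Icc 1 (T i j), (nn i j k : ℝ)) ^ 2
        - ∑ j ∈ Icc 1 p, ∑ l ∈ range (T 0 j + 1), (m j l : ℝ) ^ 2
        - ∑ i ∈ Icc 1 r, ∑ j ∈ Icc 1 (L i), ∑ k ∈ Icc 1 (T i j),
            (nn i j k : ℝ) ^ 2) := by
  have htilde : ∀ i ∈ Icc 1 r, ∀ j, tilde T m nn (i, j, 1)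
      = ∑ k ∈ Icc 1 (T i j), (nn i j k : ℝ) := by
    intro i hi j
    exact if_neg (by have := (mem_Icc.1 hi).1; simp; omega)
  have htilde0 : ∀ j ∈ Icc 1 p, tilde T m nn (0, j, 1) = n - m j 0 := by
    intro j hj
    have h : ∑ l ∈ range (T 0 j + 1), (m j l : ℝ) = n := by
      exact_mod_cast hm j (mem_Icc.1 hj).1 (mem_Icc.1 hj).2
    rw [sum_range_add_one_eq_add_sum_Icc] at h
    simp only [tilde, if_true]
    linarith
  have hn' : ∑ i ∈ Icc 1 r, ∑ j ∈ Icc 1 (L i), ∑ k ∈ Icc 1 (T i j), (nn i j k : ℝ) = n := by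
    exact_mod_cast hsum
  have hlegs : ∑ i ∈ Icc 1 r, ∑ j ∈ Icc 1 (L i), (tilde T m nn (i, j, 1) ^ 2
        + ∑ k ∈ Icc 1 (T i j), (if i = 0 then (m j k : ℝ) else nn i j k) ^ 2) =
      ∑ i ∈ Icc 1 r, ∑ j ∈ Icc 1 (L i), (∑ k ∈ Icc 1 (T i j), (nn i j k : ℝ)) ^ 2
        + ∑ i ∈ Icc 1 r, ∑ j ∈ Icc 1 (L i), ∑ k ∈ Icc 1 (T i j), (nn i j k : ℝ) ^ 2 := by
    simp only [← sum_add_distrib]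
    refine sum_congr rfl fun i hi => sum_congr rfl fun j _ => ?_
    have hi0 : i ≠ 0 := by have := (mem_Icc.1 hi).1; omega
    simp only [htilde i hi, if_neg hi0]
  have htotal : ∑ i ∈ Icc 1 r, ∑ j ∈ Icc 1 (L i), tilde T m nn (i, j, 1) = n := by
    rw [← hn']
    exact sum_congr rfl fun i hi => sum_congr rfl fun j _ => htilde i hi j
  have hsq : ∑ i ∈ Icc 1 r, (∑ j ∈ Icc 1 (L i), tilde T m nn (i, j, 1)) ^ 2 =
      ∑ i ∈ Icc 1 r, (∑ j ∈ Icc 1 (L i), ∑ k ∈ Icc 1 (T i j), (nn i j k : ℝ)) ^ 2 :=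
    sum_congr rfl fun i hi => by simp only [htilde i hi]
  have hleg_zero : ∑ j ∈ Icc 1 p, tilde T m nn (0, j, 1) = p * n - ∑ j ∈ Icc 1 p, (m j 0 : ℝ) := by
    rw [sum_congr rfl htilde0, sum_sub_distrib]
    simp
  have hleg_zero_sq : ∑ j ∈ Icc 1 p, (tilde T m nn (0, j, 1) ^ 2 + ∑ k ∈ Icc 1 (T 0 j), (m j k : ℝ) ^ 2) =
      p * (n : ℝ) ^ 2 - 2 * n * ∑ j ∈ Icc 1 p, (m j 0 : ℝ)
        + ∑ j ∈ Icc 1 p, ∑ l ∈ range (T 0 j + 1), (m j l : ℝ) ^ 2 := by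
    have hc : (p : ℝ) * (n : ℝ) ^ 2 = ∑ j ∈ Icc 1 p, (n : ℝ) ^ 2 := by simp
    rw [hc, mul_sum, ← sum_sub_distrib, ← sum_add_distrib]
    refine sum_congr rfl fun j hj => ?_
    rw [htilde0 j hj, sum_range_add_one_eq_add_sum_Icc]
    ring
  rw [form_assoc r L T m nn hT]
  simp only [sum_range_add_one_eq_add_sum_Icc r, hlegs, htotal, hsq, hL0, hleg_zero, if_true, hleg_zero_sq]
  ring
end
end

section
/- With the root-lattice data and associated element α as in the context, fix i₀ with 1 ≤ i₀ ≤ r and j₀ with 1 ≤ j₀ ≤ l_{i₀}. Let M = Σ_{j=1}^{p} Σ_{l=1}^{s_j} m^j_l and N = M + n − n_{i₀}. Let α′ be the element of 𝔥 that agrees with α in every coordinate except that its v^{i₀j₀}_1-coefficient equals (N − n^{i₀}_{j₀}) + Σ_{l=2}^{t_{i₀j₀}} n^{i₀j₀}_l (this is the element associated to the multiplicity data in which n^{i₀j₀}_1 is replaced by N − n^{i₀}_{j₀}, as produced by the twisted Euler transform E((α_{i₀}/2)x² + β^{i₀}_{j₀}x; β^{i₀}_{j₀}, ν^{i₀j₀}_1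 − 1)). Then the simple reflection satisfies r^{i₀j₀}_1(α) = α′. -/
open Finset

noncomputable section

/-- Pairing with a basis vector whose index lies in `S`. -/
theorem form_assoc_basis (r : ℕ) (L : ℕ → ℕ) (T : ℕ → ℕ → ℕ) (m : ℕ → ℕ → ℕ)
    (nn : ℕ → ℕ → ℕ → ℕ) {c : Idx} (hc : c ∈ S r L T) :
    form r L T (assoc r L T m nn) (fun b : Idx => if b = c then (1 : ℝ) else 0) =
      ∑ a ∈ S r L T, tilde T m nn a * K a c := by
  unfold form
  refine sum_congr rfl fun a ha => ?_
  rw [sum_eq_single_of_mem c hc]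
  · simp [assoc, ha]
  · intro b _ hb
    simp [hb]

/-- The contribution of the branch `(i, j)` to the pairing of a vector with `v^{i₀j₀}_1`. -/
theorem sum_branch_mul_K (f : ℕ → ℝ) {t : ℕ} (ht : 1 ≤ t) (i j i₀ j₀ : ℕ) :
    ∑ k ∈ Icc 1 t, f k * K (i, j, k) (i₀, j₀, 1) =
      -f 1 + if i = i₀ then f 1 + (if j = j₀ then 2 * f 1 - (if 2 ≤ t then f 2 else 0) else 0)
        else 0 := by
  have hK : ∀ k ∈ Icc 1 t, f k * K (i, j, k) (i₀, j₀, 1) =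
      (if k = 1 then (-f 1 + if i = i₀ then f 1 + (if j = j₀ then 2 * f 1 else 0) else 0)
        else 0) + (if k = 2 then (if i = i₀ then (if j = j₀ then -f 2 else 0) else 0) else 0) := by
    intro k hk
    have hk1 := (mem_Icc.mp hk).1
    obtain rfl | rfl | hk3 : k = 1 ∨ k = 2 ∨ 3 ≤ k := by omega
    · by_cases hi : i = i₀ <;> by_cases hj : j = j₀ <;> simp [K, hi, hj] <;> ring
    · by_cases hi : i = i₀ <;> by_cases hj : j = j₀ <;> simp [K, hi, hj]
    · have h1 : k ≠ 1 := by omega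
      have h2 : k ≠ 2 := by omega
      have h0 : k ≠ 0 := by omega
      simp [K, h1, h2, h0]
  rw [sum_congr rfl hK, sum_add_distrib, sum_ite_eq', sum_ite_eq']
  by_cases hi : i = i₀ <;> by_cases hj : j = j₀ <;> by_cases h2 : 2 ≤ t <;>
    simp [hi, hj, h2, ht] <;> ring

/-- fix `1 ≤ i₀ ≤ r` and `1 ≤ j₀ ≤ l_{i₀}`; set
`M = Σ_{j=1}^{p} Σ_{l=1}^{s_j} m^j_l` and `N = M + n − n_{i₀}`. Then the simple
reflection `r^{i₀j₀}_1(α) = α − (α, v^{i₀j₀}_1)·v^{i₀j₀}_1` equals the element `α′`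
that agrees with `α` except that its `v^{i₀j₀}_1`-coefficient equals
`(N − n^{i₀}_{j₀}) + Σ_{l=2}^{t_{i₀j₀}} n^{i₀j₀}_l`. -/
theorem stmt12 (p r n : ℕ) (hp : 1 ≤ p) (hr : 1 ≤ r) (hn : 1 ≤ n)
    (L : ℕ → ℕ) (hL0 : L 0 = p) (hL : ∀ i ≤ r, 1 ≤ L i)
    (T : ℕ → ℕ → ℕ) (hT : ∀ i ≤ r, ∀ j, 1 ≤ j → j ≤ L i → 1 ≤ T i j)
    (m : ℕ → ℕ → ℕ) (nn : ℕ → ℕ → ℕ → ℕ)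
    (hm : ∀ j, 1 ≤ j → j ≤ p → ∑ l ∈ range (T 0 j + 1), m j l = n)
    (hnn : ∀ i j k, 1 ≤ i → i ≤ r → 1 ≤ j → j ≤ L i → 1 ≤ k → k ≤ T i j →
      0 < nn i j k)
    (hsum : ∑ i ∈ Icc 1 r, ∑ j ∈ Icc 1 (L i), ∑ k ∈ Icc 1 (T i j), nn i j k = n)
    (i₀ j₀ : ℕ) (hi₀1 : 1 ≤ i₀) (hi₀2 : i₀ ≤ r) (hj₀1 : 1 ≤ j₀) (hj₀2 : j₀ ≤ L i₀) :
    (fun a : Idx =>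
        assoc r L T m nn a -
          form r L T (assoc r L T m nn)
              (fun b : Idx => if b = (i₀, j₀, 1) then (1 : ℝ) else 0) *
            (if a = (i₀, j₀, 1) then (1 : ℝ) else 0)) =
      Function.update (assoc r L T m nn) (i₀, j₀, 1)
        ((((∑ j ∈ Icc 1 p, ∑ l ∈ Icc 1 (T 0 j), (m j l : ℝ)) + (n : ℝ)
              - ∑ j ∈ Icc 1 (L i₀), ∑ k ∈ Icc 1 (T i₀ j), (nn i₀ j k : ℝ))
            - ∑ k ∈ Icc 1 (T i₀ j₀), (nn i₀ j₀ k : ℝ))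
          + ∑ l ∈ Icc 2 (T i₀ j₀), (nn i₀ j₀ l : ℝ)) := by
  have hT₀ : 1 ≤ T i₀ j₀ := hT i₀ hi₀2 j₀ hj₀1 hj₀2
  have hc : (i₀, j₀, 1) ∈ S r L T := mem_S.mpr ⟨hi₀2, ⟨hj₀1, hj₀2⟩, le_rfl, hT₀⟩
  have hi₀ : i₀ ≠ 0 := by omega
  have htilde : ∀ i j k, i ≠ 0 →
      tilde T m nn (i, j, k) = ∑ l ∈ Icc k (T i j), (nn i j l : ℝ) := by
    intro i j k hi
    simp [tilde, hi]
  have hsecond : (if 2 ≤ T i₀ j₀ then tilde T m nn (i₀, j₀, 2) else 0) =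
      ∑ l ∈ Icc 2 (T i₀ j₀), (nn i₀ j₀ l : ℝ) := by
    split_ifs with h
    · exact htilde _ _ _ hi₀
    · rw [Icc_eq_empty h, sum_empty]
  have hform : form r L T (assoc r L T m nn)
      (fun b : Idx => if b = (i₀, j₀, 1) then (1 : ℝ) else 0) =
      -(∑ i ∈ range (r + 1), ∑ j ∈ Icc 1 (L i), tilde T m nn (i, j, 1)) +
        (∑ j ∈ Icc 1 (L i₀), tilde T m nn (i₀, j, 1) +
          (2 * tilde T m nn (i₀, j₀, 1) - ∑ l ∈ Icc 2 (T i₀ j₀), (nn i₀ j₀ l : ℝ))) := by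
    rw [form_assoc_basis r L T m nn hc, sum_S]
    have hbranch : ∀ i ∈ range (r + 1), ∑ j ∈ Icc 1 (L i), ∑ k ∈ Icc 1 (T i j),
        tilde T m nn (i, j, k) * K (i, j, k) (i₀, j₀, 1) =
        -(∑ j ∈ Icc 1 (L i), tilde T m nn (i, j, 1)) +
          if i = i₀ then ∑ j ∈ Icc 1 (L i₀), tilde T m nn (i₀, j, 1) +
            (2 * tilde T m nn (i₀, j₀, 1) - ∑ l ∈ Icc 2 (T i₀ j₀), (nn i₀ j₀ l : ℝ)) else 0 := by
      intro i hi
      have hir : i ≤ r := Nat.lt_succ_iff.mp (mem_range.mp hi)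
      rw [sum_congr rfl fun j hj => sum_branch_mul_K (fun k => tilde T m nn (i, j, k))
        (hT i hir j (mem_Icc.mp hj).1 (mem_Icc.mp hj).2) i j i₀ j₀,
        sum_add_distrib, sum_neg_distrib]
      by_cases h : i = i₀
      · subst h
        simp only [if_true, sum_add_distrib]
        rw [sum_ite_eq', if_pos (mem_Icc.mpr ⟨hj₀1, hj₀2⟩), hsecond]
      · simp [h]
    rw [sum_congr rfl hbranch, sum_add_distrib, sum_neg_distrib, sum_ite_eq',
      if_pos (mem_range.mpr (Nat.lt_succ_iff.mpr hi₀2))]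
  have htotal : ∑ i ∈ range (r + 1), ∑ j ∈ Icc 1 (L i), tilde T m nn (i, j, 1) =
      (∑ j ∈ Icc 1 p, ∑ l ∈ Icc 1 (T 0 j), (m j l : ℝ)) + n := by
    rw [range_eq_Ico, sum_eq_sum_Ico_succ_bot (Nat.succ_pos r), hL0]
    congr 1
    rw [← hsum]
    push_cast
    refine sum_congr rfl fun i hi => sum_congr rfl fun j _ => htilde i j 1 ?_
    have := (mem_Ico.mp hi).1
    omega
  funext a
  by_cases ha : a = (i₀, j₀, 1)
  · subst ha
    rw [Function.update_self, hform, htotal, if_pos rfl, assoc, if_pos hc,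
      sum_congr rfl fun j _ => htilde i₀ j 1 hi₀, htilde i₀ j₀ 1 hi₀]
    ring
  · rw [Function.update_of_ne ha, if_neg ha, mul_zero, sub_zero]
end
end
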